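/- Let R > 0, θ(r,ε) = 2 arctan(r) + (r(1−r²)/(1+r²)²) ε, and B(r,ε) = R² (1 + ε sin²(θ(r,ε))) (∂θ/∂r(r,ε))² for r > 0. Then ∂B/∂ε(r,0) = 4R²(1−r²)²/(1+r²)⁴ for every r > 0. Consequently the conformal factor of the ellipsoid of revolution in these coordinates is h(r)² = (4R²/(1+r²)²)·(1 + ((1−r²)²/(1+r²)²) ε) + O(ε²), i.e. h(r) = h₀(r) + ε h₁(r) + O(ε²) with h₀(r) = 2R/(1+r²) and h₁(r) = R(1−r²)²/(1+r²)³. -/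

import Mathlib

open Real Asymptotics

/-- The perturbed coordinate change `θ(r,ε) = 2 arctan r + (r(1−r²)/(1+r²)²) ε`. -/
noncomputable def θf (r ε : ℝ) : ℝ :=
  2 * Real.arctan r + (r * (1 - r ^ 2) / (1 + r ^ 2) ^ 2) * ε

/-- Radial metric coefficient `B(r,ε) = R²(1+ε sin²(θ(r,ε)))(∂θ/∂r)²`, the square of the
conformal factor of the ellipsoid of revolution in the coordinates `(r,ψ)`. -/
noncomputable def Bcoef (R r ε : ℝ) : ℝ :=
  R ^ 2 * (1 + ε * Real.sin (θf r ε) ^ 2) * (deriv (fun s => θf s ε) r) ^ 2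

theorem AnalyticAt.isBigO_sub_linear {f : ℝ → ℝ} {f' : ℝ} (hf : AnalyticAt ℝ f 0)
    (hd : HasDerivAt f f' 0) :
    (fun x => f x - (f 0 + f' * x)) =O[nhds 0] fun x => x ^ 2 := by
  obtain ⟨p, hp⟩ := hf
  have hcoeff : p.coeff 1 = f' := hp.hasDerivAt.unique hd
  have hconst : p.coeff 0 = f 0 := hp.coeff_zero _
  have h := hp.isBigO_sub_partialSum_pow 2
  simp only [zero_add, FormalMultilinearSeries.partialSum, Finset.sum_range_succ,
    Finset.range_zero, Finset.sum_empty, FormalMultilinearSeries.apply_eq_pow_smul_coeff,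
    hcoeff, hconst, pow_zero, pow_one, smul_eq_mul, one_mul] at h
  simpa only [mul_comm f', norm_pow, isBigO_norm_right] using h.trans
    (isBigO_of_le _ fun x => by simp)

theorem hasDerivAt_θf (r ε : ℝ) :
    HasDerivAt (fun s => θf s ε)
      (2 / (1 + r ^ 2) + (1 - 6 * r ^ 2 + r ^ 4) / (1 + r ^ 2) ^ 3 * ε) r := by
  have hr : 1 + r ^ 2 ≠ 0 := by positivity
  have hnum : HasDerivAt (fun s : ℝ => s * (1 - s ^ 2)) (1 - 3 * r ^ 2) r := by
    refine ((hasDerivAt_id r).mul ((hasDerivAt_pow 2 r).const_sub 1)).congr_deriv ?_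
    simp
    ring
  have hden : HasDerivAt (fun s : ℝ => (1 + s ^ 2) ^ 2) (4 * r * (1 + r ^ 2)) r := by
    refine (((hasDerivAt_pow 2 r).const_add 1).pow 2).congr_deriv ?_
    simp
    ring
  refine (((hasDerivAt_arctan r).const_mul 2).add
    ((hnum.div hden (pow_ne_zero 2 hr)).mul_const ε)).congr_deriv ?_
  field_simp
  ring

theorem Bcoef_eq (R r ε : ℝ) :
    Bcoef R r ε = R ^ 2 * (1 + ε * sin (θf r ε) ^ 2) *
      (2 / (1 + r ^ 2) + (1 - 6 * r ^ 2 + r ^ 4) / (1 + r ^ 2) ^ 3 * ε) ^ 2 := by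
  rw [Bcoef, (hasDerivAt_θf r ε).deriv]

theorem Real.sin_two_mul_arctan_sq (r : ℝ) :
    sin (2 * arctan r) ^ 2 = 4 * r ^ 2 / (1 + r ^ 2) ^ 2 := by
  rw [sin_two_mul, mul_pow, mul_pow, cos_sq_arctan, sin_sq, cos_sq_arctan]
  field_simp
  ring

theorem Bcoef_zero (R r : ℝ) : Bcoef R r 0 = (2 * R / (1 + r ^ 2)) ^ 2 := by
  rw [Bcoef_eq]
  ring

theorem analyticAt_Bcoef (R r ε : ℝ) : AnalyticAt ℝ (fun ε => Bcoef R r ε) ε := by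
  simp only [Bcoef_eq, θf]
  fun_prop

theorem hasDerivAt_Bcoef_zero (R r : ℝ) :
    HasDerivAt (fun ε => Bcoef R r ε) (4 * R ^ 2 * (1 - r ^ 2) ^ 2 / (1 + r ^ 2) ^ 4) 0 := by
  have hr : 1 + r ^ 2 ≠ 0 := by positivity
  have hθ : DifferentiableAt ℝ (fun ε => sin (θf r ε) ^ 2) 0 := by
    unfold θf
    fun_prop
  have hprod := ((hasDerivAt_id (0 : ℝ)).mul hθ.hasDerivAt).const_add 1
  have hlin := ((hasDerivAt_id (0 : ℝ)).const_mul
    ((1 - 6 * r ^ 2 + r ^ 4) / (1 + r ^ 2) ^ 3)).const_add (2 / (1 + r ^ 2))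
  have h := (hprod.const_mul (R ^ 2)).mul (hlin.pow 2)
  simp only [Bcoef_eq]
  refine h.congr_deriv ?_
  simp [θf, sin_two_mul_arctan_sq]
  field_simp
  ring

/-- `∂B/∂ε(r,0) = 4R²(1−r²)²/(1+r²)⁴` for every `r > 0`; consequently
the squared conformal factor is
`h(r)² = (4R²/(1+r²)²)(1 + ((1−r²)²/(1+r²)²) ε) + O(ε²)`, i.e.
`h(r) = h₀(r) + ε h₁(r) + O(ε²)` with `h₀(r) = 2R/(1+r²)` and
`h₁(r) = R(1−r²)²/(1+r²)³`. -/
theorem conformal_factor_first_order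
    (R : ℝ) (hR : 0 < R) (r : ℝ) (hr : 0 < r) :
    deriv (fun ε => Bcoef R r ε) 0 = 4 * R ^ 2 * (1 - r ^ 2) ^ 2 / (1 + r ^ 2) ^ 4 ∧
    ((fun ε => Bcoef R r ε
        - 4 * R ^ 2 / (1 + r ^ 2) ^ 2 * (1 + (1 - r ^ 2) ^ 2 / (1 + r ^ 2) ^ 2 * ε))
      =O[nhds 0] fun ε => ε ^ 2) ∧
    ((fun ε => Real.sqrt (Bcoef R r ε)
        - (2 * R / (1 + r ^ 2) + ε * (R * (1 - r ^ 2) ^ 2 / (1 + r ^ 2) ^ 3)))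
      =O[nhds 0] fun ε => ε ^ 2) := by
  have hB := hasDerivAt_Bcoef_zero R r
  have hB₀ : Bcoef R r 0 ≠ 0 := by
    rw [Bcoef_zero]
    positivity
  have hsqrt₀ : √(Bcoef R r 0) = 2 * R / (1 + r ^ 2) := by
    rw [Bcoef_zero, sqrt_sq (by positivity)]
  refine ⟨hB.deriv, ?_, ?_⟩
  · refine ((analyticAt_Bcoef R r 0).isBigO_sub_linear hB).congr_left fun ε => ?_
    rw [Bcoef_zero]
    field_simp
    ring
  · have hsqrt : AnalyticAt ℝ (fun ε => √(Bcoef R r ε)) 0 :=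
      ((analyticAt_Bcoef R r 0).contDiffAt.sqrt hB₀).analyticAt
    refine (hsqrt.isBigO_sub_linear (hB.sqrt hB₀)).congr_left fun ε => ?_
    rw [hsqrt₀]
    field_simp
    ring
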